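/- Let λ = 3 and μ = 4 (so ρ = 3/4). Then ETT(3, 7) < ETT(7, 3), where ETT(a, b) = (a+2)/μ + (1/μ)·∫₀^∞ f_{a+1}(t)·EL_b(t) dt with f_{a+1}(t) = μ^{a+1} t^a e^{−μ t}/a! and EL_b given by the explicit integral formula. That is, for initial lengths 3 and 7, joining the shorter queue first yields a strictly smaller expected total time. -/

import Mathlib

open Real MeasureTheory Set Filter

/-- γ(y) = 1 + ρ − 2√ρ·cos(y). -/
noncomputable def gam (ρ y : ℝ) : ℝ := 1 + ρ - 2 * Real.sqrt ρ * Real.cos y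

/-- a_k(y) = sin(k·y) − √ρ·sin((k+1)·y). -/
noncomputable def aco (ρ : ℝ) (k : ℕ) (y : ℝ) : ℝ :=
  Real.sin ((k : ℝ) * y) - Real.sqrt ρ * Real.sin (((k : ℝ) + 1) * y)

/-- Transient expected queue length of an M/M/1 queue started with `i` customers. -/
noncomputable def EL (lam mu : ℝ) (i : ℕ) (t : ℝ) : ℝ :=
  (2 / Real.pi) * (lam / mu) ^ ((1 - (i : ℝ)) / 2) *
    (∫ y in (0 : ℝ)..Real.pi,
      Real.exp (-(mu * t * gam (lam / mu) y)) / (gam (lam / mu) y) ^ 2 *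
        (aco (lam / mu) i y * Real.sin y)) +
  (lam / mu) / (1 - lam / mu)

/-- Transient probability that an M/M/1 queue started with `i` customers has `j` at time `t`. -/
noncomputable def pq (lam mu : ℝ) (i j : ℕ) (t : ℝ) : ℝ :=
  (2 / Real.pi) * (lam / mu) ^ (((j : ℝ) - (i : ℝ)) / 2) *
    (∫ y in (0 : ℝ)..Real.pi,
      Real.exp (-(mu * t * gam (lam / mu) y)) / gam (lam / mu) y *
        (aco (lam / mu) i y * aco (lam / mu) j y)) +
  (1 - lam / mu) * (lam / mu) ^ j

/-- Erlang(n) density with rate `mu`: f_n(t) = μⁿ t^{n−1} e^{−μt}/(n−1)!. -/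
noncomputable def erl (mu : ℝ) (n : ℕ) (t : ℝ) : ℝ :=
  mu ^ n * t ^ (n - 1) * Real.exp (-(mu * t)) / (Nat.factorial (n - 1) : ℝ)

/-- Expected total time to complete queue with `a` customers first, then queue with `b`. -/
noncomputable def ETT (lam mu : ℝ) (a b : ℕ) : ℝ :=
  ((a : ℝ) + 2) / mu + (1 / mu) * ∫ t in Set.Ioi (0 : ℝ), erl mu (a + 1) t * EL lam mu b t


/-- Upper bounds (scaled by 10^5) for the resolvent table. -/
def upT : List (List ℤ) :=
  [[0, 0, 0, 0, 0, 0, 0, 0, 0, 0, 0, 0, 0, 0, 0, 0, 0, 0],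
   [0, 40935, 16757, 6861, 2810, 1153, 477, 210, 129, 192, 529, 1680, 5452, 17749, 57806, 188287, 613309, 1997746],
   [0, 101033, 49203, 23355, 10880, 5005, 2304, 1135, 806, 1268, 3316, 9759, 29117, 86480, 254602, 741157, 2127053, 5993238],
   [0, 171392, 93723, 49521, 25469, 12850, 6480, 3552, 2868, 4703, 11726, 32302, 89791, 247337, 671873, 1794279, 4694979, 11986476],
   [0, 247937, 147243, 84341, 46894, 25529, 13943, 8444, 7631, 12896, 30837, 80237, 210015, 543347, 1382468, 3448751, 8409756, 19977460],
   [0, 328583, 207551, 126583, 74946, 43495, 25512, 16957, 16899, 29174, 67244, 166543, 414013, 1015966, 2448727, 5780752, 13332783, 29966190],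
   [0, 412152, 273108, 175124, 109196, 66956, 41913, 30389, 32931, 57693, 128732, 305430, 726208, 1703503, 3923276, 8849034, 19507753, 41952666],
   [0, 497922, 342840, 229036, 149178, 96007, 63842, 50193, 58396, 103282, 223914, 511664, 1170305, 2640619, 5850522, 12700052, 26967445, 55936888],
   [0, 585423, 415986, 287594, 194481, 130729, 92021, 77980, 96305, 171279, 361904, 800056, 1768778, 3858370, 8268156, 17371379, 35737443, 71918856]]

/-- Lower bounds (scaled by 10^5) for the resolvent table. -/
def loT : List (List ℤ) :=
  [[0, 0, 0, 0, 0, 0, 0, 0, 0, 0, 0, 0, 0, 0, 0, 0, 0, 0],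
   [0, 40932, 16753, 6856, 2805, 1146, 464, 175, 28, -128, -503, -1669, -5448, -17747, -57805, -188287, -613309, -1997746],
   [0, 101027, 49195, 23344, 10864, 4972, 2221, 897, 99, -868, -3140, -9681, -29084, -86465, -254596, -741154, -2127053, -5993238],
   [0, 171384, 93709, 49496, 25418, 12724, 6136, 2575, 68, -3312, -11074, -31998, -89651, -247273, -671844, -1794266, -4694974, -11986476],
   [0, 247924, 147214, 84278, 46743, 25131, 12860, 5467, -531, -9325, -29064, -79367, -209592, -543144, -1382371, -3448706, -8409737, -19977460],
   [0, 328559, 207487, 126426, 74543, 42437, 22706, 9529, -2622, -21606, -63292, -164507, -412976, -1015445, -2448469, -5780627, -13332731, -29966190],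
   [0, 412102, 272964, 174753, 108246, 64508, 35622, 14332, -7649, -43657, -121065, -301305, -724018, -1702356, -3922684, -8848739, -19507626, -41952666],
   [0, 497817, 342529, 228235, 147156, 90935, 51211, 19035, -17591, -79681, -210496, -504155, -1166164, -2638368, -5849320, -12699433, -26967174, -55936888],
   [0, 585212, 415359, 285999, 190540, 121110, 68772, 22405, -34920, -134457, -340205, -787476, -1761597, -3854332, -8265929, -17370201, -35736916, -71918856]]

def upF (j m : ℕ) : ℤ := (upT.getD j []).getD m 0
def loF (j m : ℕ) : ℤ := (loT.getD j []).getD m 0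

lemma up_check : ∀ j : ℕ, j < 8 → ∀ m : ℕ, m < 16 →
    (if m = 0 then 400000 * ((j : ℤ) + 1) else 0) + 4 * upF j (m + 1) + 3 * upF (j + 1) (m + 2)
      + 4 * upF (j + 1) m ≤ 11 * upF (j + 1) (m + 1) := by
  decide +kernel

lemma lo_check : ∀ j : ℕ, j < 8 → ∀ m : ℕ, m < 16 →
    11 * loF (j + 1) (m + 1) ≤
    (if m = 0 then 400000 * ((j : ℤ) + 1) else 0) + 4 * loF j (m + 1) + 3 * loF (j + 1) (m + 2)
      + 4 * loF (j + 1) m := by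
  decide +kernel

lemma bd_check : (∀ j : ℕ, j < 9 → 998873 * ((j : ℤ) * (j + 1)) ≤ upF j 17 ∧
    loF j 17 ≤ -(998873 * ((j : ℤ) * (j + 1))) ∧ upF j 0 = 0 ∧ loF j 0 = 0) ∧
    (∀ m : ℕ, m < 18 → upF 0 m = 0 ∧ loF 0 m = 0) := by
  decide +kernel

lemma fin_check : 400000 + (4 * upF 4 7 - 3 * loF 4 8) < 4 * loF 8 3 - 3 * upF 8 4 := by
  decide +kernel

/-- Discrete maximum principle. -/
lemma max_principle (e : ℕ → ℝ) (h0 : e 0 ≤ 0) (h17 : e 17 ≤ 0)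
    (h : ∀ m < 16, 11 * e (m + 1) ≤ 3 * e (m + 2) + 4 * e m) : ∀ m < 18, e m ≤ 0 := by
  obtain ⟨k, hk, hmax⟩ := Finset.exists_max_image (Finset.range 18) e ⟨0, by simp⟩
  simp only [Finset.mem_range] at hk hmax
  have hk0 : e k ≤ 0 := by
    rcases Nat.eq_zero_or_pos k with h1 | h1
    · rw [h1]; exact h0
    by_cases h2 : k = 17
    · rw [h2]; exact h17
    obtain ⟨m, rfl⟩ : ∃ m, k = m + 1 := ⟨k - 1, by omega⟩
    have := h m (by omega)
    have := hmax m (by omega)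
    have := hmax (m + 2) (by omega)
    linarith
  intro m hm
  exact (hmax m hm).trans hk0

lemma table_bound (W : ℕ → ℕ → ℝ) (hz : ∀ m, W 0 m = 0) (h0 : ∀ j, W j 0 = 0)
    (hrec : ∀ j m, 11 / 4 * W (j + 1) (m + 1) =
      (if m = 0 then ((j : ℝ) + 1) else 0) + W j (m + 1) + 3 / 4 * W (j + 1) (m + 2)
        + W (j + 1) m)
    (hB : ∀ j, |W j 17| ≤ (j : ℝ) * (j + 1) * (4 / 3) ^ 8) :
    ∀ j < 9, ∀ m < 18, 100000 * W j m ≤ upF j m ∧ (loF j m : ℝ) ≤ 100000 * W j m := by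
  intro j
  induction j with
  | zero =>
    intro _ m hm
    have := bd_check.2 m hm
    rw [this.1, this.2, hz]; simp
  | succ j ih =>
    intro hj
    have ih := ih (by omega)
    obtain ⟨b1, b2, b3, b4⟩ := bd_check.1 (j + 1) hj
    have b1' : (998873 * (((j + 1 : ℕ) : ℝ) * ((j + 1 : ℕ) + 1))) ≤ (upF (j + 1) 17 : ℝ) := by
      exact_mod_cast b1
    have b2' : (loF (j + 1) 17 : ℝ) ≤ -(998873 * (((j + 1 : ℕ) : ℝ) * ((j + 1 : ℕ) + 1))) := by
      exact_mod_cast b2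
    have hb := abs_le.1 (hB (j + 1))
    have hp : (0 : ℝ) ≤ ((j + 1 : ℕ) : ℝ) * ((j + 1 : ℕ) + 1) := by positivity
    have hq : ((j + 1 : ℕ) : ℝ) * ((j + 1 : ℕ) + 1) * (4 / 3) ^ 8 * 100000
        ≤ 998873 * (((j + 1 : ℕ) : ℝ) * ((j + 1 : ℕ) + 1)) := by
      generalize ((j + 1 : ℕ) : ℝ) * ((j + 1 : ℕ) + 1) = z at *
      norm_num
      linarith
    have hu := max_principle (fun m => 100000 * W (j + 1) m - upF (j + 1) m)
      (by simp [h0, b3]) (by linarith [hb.2]) (by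
        intro m hm
        have c := up_check j (by omega) m hm
        have c' : ((if m = 0 then 400000 * ((j : ℝ) + 1) else 0) + 4 * (upF j (m + 1) : ℝ)
          + 3 * upF (j + 1) (m + 2) + 4 * upF (j + 1) m) ≤ 11 * upF (j + 1) (m + 1) := by
          exact_mod_cast c
        have r := hrec j m
        have i := (ih (m + 1) (by omega)).1
        split_ifs at c' r <;> linarith)
    have hl := max_principle (fun m => loF (j + 1) m - 100000 * W (j + 1) m)
      (by simp [h0, b4]) (by linarith [hb.1]) (by
        intro m hm
        have c := lo_check j (by omega) m hm
        have c' : (11 * loF (j + 1) (m + 1) : ℝ) ≤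
          ((if m = 0 then 400000 * ((j : ℝ) + 1) else 0) + 4 * (loF j (m + 1) : ℝ)
          + 3 * loF (j + 1) (m + 2) + 4 * loF (j + 1) m) := by
          exact_mod_cast c
        have r := hrec j m
        have i := (ih (m + 1) (by omega)).2
        split_ifs at c' r <;> linarith)
    intro m hm
    have := hu m hm
    have := hl m hm
    constructor <;> linarith

lemma table_final (W : ℕ → ℕ → ℝ) (hz : ∀ m, W 0 m = 0) (h0 : ∀ j, W j 0 = 0)
    (hrec : ∀ j m, 11 / 4 * W (j + 1) (m + 1) =
      (if m = 0 then ((j : ℝ) + 1) else 0) + W j (m + 1) + 3 / 4 * W (j + 1) (m + 2)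
        + W (j + 1) m)
    (hB : ∀ j, |W j 17| ≤ (j : ℝ) * (j + 1) * (4 / 3) ^ 8) :
    1 + (W 4 7 - 3 / 4 * W 4 8) < W 8 3 - 3 / 4 * W 8 4 := by
  have T := table_bound W hz h0 hrec hB
  have f : (400000 + (4 * upF 4 7 - 3 * loF 4 8) : ℝ) < 4 * loF 8 3 - 3 * upF 8 4 := by
    exact_mod_cast fin_check
  have t1 := T 4 (by norm_num) 7 (by norm_num)
  have t2 := T 4 (by norm_num) 8 (by norm_num)
  have t3 := T 8 (by norm_num) 3 (by norm_num)
  have t4 := T 8 (by norm_num) 4 (by norm_num)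
  linarith [t1.1, t2.2, t3.2, t4.1]

/-- The square root of ρ = 3/4. -/
noncomputable def rr : ℝ := Real.sqrt (3 / 4)

lemma rr_pos : 0 < rr := Real.sqrt_pos.2 (by norm_num)
lemma rr_sq : rr ^ 2 = 3 / 4 := Real.sq_sqrt (by norm_num)
lemma rr_lt : rr < 1 := by nlinarith [rr_pos, rr_sq]

/-- γ for ρ = 3/4. -/
noncomputable def gg (y : ℝ) : ℝ := 7 / 4 - 2 * rr * Real.cos y

lemma gam_eq (y : ℝ) : gam (3 / 4) y = gg y := by
  unfold gam gg rr; ring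

lemma gg_lower (y : ℝ) : (1 - rr) ^ 2 ≤ gg y := by
  unfold gg
  nlinarith [Real.cos_le_one y, rr_pos, rr_sq]

lemma gg_pos (y : ℝ) : 0 < gg y :=
  lt_of_lt_of_le (pow_pos (by linarith [rr_lt]) 2) (gg_lower y)

@[fun_prop]
lemma gg_cont : Continuous gg := by unfold gg; fun_prop

/-- Horner form of the regular part of the partial fraction expansion. -/
noncomputable def qq : ℕ → ℝ → ℝ
  | 0, _ => 0
  | j + 1, y => ((j : ℝ) + 1 + qq j y) / (1 + gg y)

lemma qq_cont (j : ℕ) : Continuous (qq j) := by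
  induction j with
  | zero => exact continuous_const
  | succ j ih =>
    have : qq (j + 1) = fun y => ((j : ℝ) + 1 + qq j y) / (1 + gg y) := by
      funext y; rfl
    rw [this]
    exact Continuous.div (by fun_prop) (by fun_prop) (fun y => by linarith [gg_pos y])

lemma qq_bound (j : ℕ) (y : ℝ) : 0 ≤ qq j y ∧ qq j y ≤ (j : ℝ) * (j + 1) / 2 := by
  induction j with
  | zero => simp [qq]
  | succ j ih =>
    have hg := gg_pos y
    have hj : (0 : ℝ) ≤ j := Nat.cast_nonneg j
    simp only [qq]
    constructor
    · exact div_nonneg (by linarith [ih.1]) (by linarith)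
    · rw [div_le_iff₀ (by linarith)]
      push_cast
      have : (0 : ℝ) ≤ ((j : ℝ) + 1) * (j + 1 + 1) / 2 * gg y := by positivity
      nlinarith [ih.2]

lemma partial_fraction (n : ℕ) (y : ℝ) :
    1 / (gg y ^ 2 * (1 + gg y) ^ n) = 1 / gg y ^ 2 - n * (1 / gg y) + qq n y := by
  have hg := gg_pos y
  induction n with
  | zero => simp [qq]
  | succ n ih =>
    have h1 : (1 : ℝ) + gg y ≠ 0 := by linarith
    have : 1 / (gg y ^ 2 * (1 + gg y) ^ (n + 1))
        = (1 / (gg y ^ 2 * (1 + gg y) ^ n)) / (1 + gg y) := by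
      rw [pow_succ (1 + gg y) n, ← mul_assoc, ← div_div]
    rw [this, ih]
    simp only [qq]
    field_simp
    push_cast
    ring

lemma int_cos (m : ℕ) : ∫ y in (0 : ℝ)..Real.pi, Real.cos (((m + 1 : ℕ) : ℝ) * y) = 0 := by
  have h : ((m + 1 : ℕ) : ℝ) ≠ 0 := by positivity
  rw [intervalIntegral.integral_comp_mul_left (fun x => Real.cos x) h, integral_cos,
    Real.sin_nat_mul_pi]
  simp

/-- Fourier coefficients of 1/γ. -/
noncomputable def cc (m : ℕ) : ℝ := ∫ y in (0 : ℝ)..Real.pi, Real.cos ((m : ℝ) * y) / gg y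

lemma inv_gg_cont : Continuous (fun y => (gg y)⁻¹) :=
  gg_cont.inv₀ (fun y => (gg_pos y).ne')

lemma cc_int (m : ℕ) : IntervalIntegrable (fun y => Real.cos ((m : ℝ) * y) / gg y)
    volume 0 Real.pi := by
  apply Continuous.intervalIntegrable
  have := inv_gg_cont
  simp only [div_eq_mul_inv]
  fun_prop

lemma cc_rec (m : ℕ) : 7 / 4 * cc (m + 1) - rr * (cc (m + 2) + cc m) = 0 := by
  unfold cc
  rw [← intervalIntegral.integral_add (cc_int _) (cc_int _),
    ← intervalIntegral.integral_const_mul, ← intervalIntegral.integral_const_mul,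
    ← intervalIntegral.integral_sub ((cc_int _).const_mul _)
      (((cc_int _).add (cc_int _)).const_mul _)]
  refine Eq.trans ?_ (int_cos m)
  apply intervalIntegral.integral_congr
  intro y _
  have hg := (gg_pos y).ne'
  have e1 : Real.cos (((m + 2 : ℕ) : ℝ) * y) + Real.cos ((m : ℝ) * y)
      = 2 * Real.cos (((m + 1 : ℕ) : ℝ) * y) * Real.cos y := by
    have a1 : ((m + 2 : ℕ) : ℝ) * y = ((m + 1 : ℕ) : ℝ) * y + y := by push_cast; ring
    have a2 : (m : ℝ) * y = ((m + 1 : ℕ) : ℝ) * y - y := by push_cast; ring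
    rw [a1, a2, Real.cos_add, Real.cos_sub]; ring
  simp only
  rw [← add_div, e1]
  field_simp
  unfold gg
  ring

lemma cc_zero : 7 / 4 * cc 0 - 2 * rr * cc 1 = Real.pi := by
  unfold cc
  rw [← intervalIntegral.integral_const_mul, ← intervalIntegral.integral_const_mul,
    ← intervalIntegral.integral_sub ((cc_int _).const_mul _) ((cc_int _).const_mul _)]
  have : ∀ y ∈ Set.uIcc 0 Real.pi, 7 / 4 * (Real.cos (((0 : ℕ) : ℝ) * y) / gg y)
      - 2 * rr * (Real.cos (((1 : ℕ) : ℝ) * y) / gg y) = 1 := by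
    intro y _
    have hg := (gg_pos y).ne'
    simp only [Nat.cast_zero, zero_mul, Real.cos_zero, Nat.cast_one, one_mul]
    field_simp
    unfold gg
    ring
  rw [intervalIntegral.integral_congr this]
  simp

lemma cc_bound (m : ℕ) : |cc m| ≤ 1 / (1 - rr) ^ 2 * Real.pi := by
  have h := intervalIntegral.norm_integral_le_of_norm_le_const (a := 0) (b := Real.pi)
    (C := 1 / (1 - rr) ^ 2) (f := fun y => Real.cos ((m : ℝ) * y) / gg y) (by
      intro y _
      rw [Real.norm_eq_abs, abs_div, abs_of_pos (gg_pos y)]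
      have h1 : 0 < (1 - rr) ^ 2 := pow_pos (by linarith [rr_lt]) 2
      exact div_le_div₀ zero_le_one (Real.abs_cos_le_one _) h1 (gg_lower y))
  rw [sub_zero, abs_of_pos Real.pi_pos] at h
  exact h

lemma cc_step (m : ℕ) : cc (m + 1) = rr * cc m := by
  have hd : ∀ m, cc (m + 1) - rr * cc m = rr * (cc (m + 2) - rr * cc (m + 1)) := by
    intro m
    linear_combination cc_rec m + cc (m + 1) * rr_sq
  have hk : ∀ k m, cc (m + 1) - rr * cc m
      = rr ^ k * (cc (m + k + 1) - rr * cc (m + k)) := by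
    intro k
    induction k with
    | zero => intro m; simp
    | succ k ih =>
      intro m
      rw [ih m, hd (m + k), pow_succ]
      have : m + (k + 1) = m + k + 1 := by ring
      rw [this]; ring
  set K := 1 / (1 - rr) ^ 2 * Real.pi with hK
  have hb : ∀ k, |cc (m + 1) - rr * cc m| ≤ rr ^ k * (2 * K) := by
    intro k
    rw [hk k m, abs_mul, abs_of_pos (pow_pos rr_pos k)]
    apply mul_le_mul_of_nonneg_left _ (pow_pos rr_pos k).le
    have h1 := cc_bound (m + k + 1)
    have h2 := cc_bound (m + k)
    have h3 : |rr * cc (m + k)| ≤ K := by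
      rw [abs_mul, abs_of_pos rr_pos]
      nlinarith [abs_nonneg (cc (m + k)), rr_lt, rr_pos]
    have := abs_sub (cc (m + k + 1)) (rr * cc (m + k))
    linarith
  have ht : Tendsto (fun k : ℕ => rr ^ k * (2 * K)) atTop (nhds (0 * (2 * K))) :=
    (tendsto_pow_atTop_nhds_zero_of_lt_one rr_pos.le rr_lt).mul_const _
  rw [zero_mul] at ht
  have h0 := ge_of_tendsto' ht hb
  have := abs_nonpos_iff.1 h0
  linarith

lemma cc_val (m : ℕ) : cc m = 4 * Real.pi * rr ^ m := by
  induction m with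
  | zero =>
    have h1 := cc_zero
    rw [cc_step 0] at h1
    have : cc 0 = 4 * Real.pi := by linear_combination 4 * h1 + 8 * cc 0 * rr_sq
    simp [this]
  | succ m ih => rw [cc_step, ih, pow_succ]; ring

lemma aco_cont (i : ℕ) : Continuous (aco (3 / 4) i) := by unfold aco; fun_prop

/-- The 1/γ term. -/
lemma int_one (i : ℕ) : ∫ y in (0 : ℝ)..Real.pi, aco (3 / 4) (i + 1) y * Real.sin y * (1 / gg y)
    = Real.pi / 8 * rr ^ i := by
  have : ∀ y ∈ Set.uIcc 0 Real.pi, aco (3 / 4) (i + 1) y * Real.sin y * (1 / gg y) =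
      1 / 2 * (Real.cos ((i : ℝ) * y) / gg y - Real.cos (((i + 2 : ℕ) : ℝ) * y) / gg y)
      - rr / 2 * (Real.cos (((i + 1 : ℕ) : ℝ) * y) / gg y
        - Real.cos (((i + 3 : ℕ) : ℝ) * y) / gg y) := by
    intro y _
    have hg := (gg_pos y).ne'
    have a1 : (i : ℝ) * y = ((i + 1 : ℕ) : ℝ) * y - y := by push_cast; ring
    have a2 : ((i + 2 : ℕ) : ℝ) * y = ((i + 1 : ℕ) : ℝ) * y + y := by push_cast; ring
    have a3 : ((i + 1 : ℕ) : ℝ) * y = (((i + 1 : ℕ) : ℝ) + 1) * y - y := by ring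
    have a4 : ((i + 3 : ℕ) : ℝ) * y = (((i + 1 : ℕ) : ℝ) + 1) * y + y := by push_cast; ring
    have e1 : Real.cos ((i : ℝ) * y) - Real.cos (((i + 2 : ℕ) : ℝ) * y)
        = 2 * Real.sin (((i + 1 : ℕ) : ℝ) * y) * Real.sin y := by
      rw [a1, a2, Real.cos_add, Real.cos_sub]; ring
    have e2 : Real.cos (((i + 1 : ℕ) : ℝ) * y) - Real.cos (((i + 3 : ℕ) : ℝ) * y)
        = 2 * Real.sin ((((i + 1 : ℕ) : ℝ) + 1) * y) * Real.sin y := by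
      rw [a3, a4, Real.cos_add, Real.cos_sub]; ring
    rw [← sub_div, ← sub_div, e1, e2]
    unfold aco
    rw [← rr]
    ring
  rw [intervalIntegral.integral_congr this, intervalIntegral.integral_sub
    (((cc_int _).sub (cc_int _)).const_mul _) (((cc_int _).sub (cc_int _)).const_mul _),
    intervalIntegral.integral_const_mul, intervalIntegral.integral_const_mul,
    intervalIntegral.integral_sub (cc_int _) (cc_int _),
    intervalIntegral.integral_sub (cc_int _) (cc_int _)]
  have h0 := cc_val i
  have h1 := cc_val (i + 1)
  have h2 := cc_val (i + 2)
  have h3 := cc_val (i + 3)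
  unfold cc at h0 h1 h2 h3
  rw [h0, h1, h2, h3]
  linear_combination (2 * Real.pi * rr ^ i * (rr ^ 2 - 5 / 4)) * rr_sq

/-- The 1/γ² term. -/
lemma int_two (i : ℕ) : ∫ y in (0 : ℝ)..Real.pi,
    aco (3 / 4) (i + 1) y * Real.sin y * (1 / gg y ^ 2)
    = Real.pi / 2 * rr ^ i * ((i : ℝ) - 2) := by
  have hv : ∀ y, HasDerivAt (fun y => -(1 / (2 * rr)) * (gg y)⁻¹)
      (Real.sin y * (1 / gg y ^ 2)) y := by
    intro y
    have hg : HasDerivAt gg (2 * rr * Real.sin y) y := by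
      have := ((Real.hasDerivAt_cos y).const_mul (2 * rr)).const_sub (7 / 4)
      convert! this using 1
      ring
    convert! (hg.inv (gg_pos y).ne').const_mul (-(1 / (2 * rr))) using 1
    have := rr_pos.ne'
    have := (gg_pos y).ne'
    field_simp
  have hu : ∀ y, HasDerivAt (aco (3 / 4) (i + 1))
      (((i + 1 : ℕ) : ℝ) * Real.cos (((i + 1 : ℕ) : ℝ) * y)
        - rr * (((i + 2 : ℕ) : ℝ) * Real.cos (((i + 2 : ℕ) : ℝ) * y))) y := by
    intro y
    have l1 : HasDerivAt (fun y => Real.sin (((i + 1 : ℕ) : ℝ) * y))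
      (Real.cos (((i + 1 : ℕ) : ℝ) * y) * (((i + 1 : ℕ) : ℝ) * 1)) y :=
      ((hasDerivAt_id y).const_mul _).sin
    have l2 : HasDerivAt (fun y => Real.sin ((((i + 1 : ℕ) : ℝ) + 1) * y))
      (Real.cos ((((i + 1 : ℕ) : ℝ) + 1) * y) * ((((i + 1 : ℕ) : ℝ) + 1) * 1)) y :=
      ((hasDerivAt_id y).const_mul _).sin
    convert! l1.sub (l2.const_mul rr) using 1
    push_cast
    have : (i : ℝ) + 1 + 1 = i + 2 := by ring
    rw [this]
    ring
  have hc := inv_gg_cont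
  have hparts := intervalIntegral.integral_mul_deriv_eq_deriv_mul (a := 0) (b := Real.pi)
    (fun y _ => hu y) (fun y _ => hv y)
    (Continuous.intervalIntegrable (by fun_prop) _ _)
    (Continuous.intervalIntegrable (by
      have : (fun y => Real.sin y * (1 / gg y ^ 2)) = fun y => Real.sin y * ((gg y)⁻¹) ^ 2 := by
        funext y; simp
      rw [this]; fun_prop) _ _)
  have b0 : aco (3 / 4) (i + 1) 0 = 0 := by simp [aco]
  have bp : aco (3 / 4) (i + 1) Real.pi = 0 := by
    unfold aco
    rw [Real.sin_nat_mul_pi]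
    have := Real.sin_nat_mul_pi (i + 1 + 1)
    rw [Nat.cast_succ] at this
    rw [this]; simp
  simp only [mul_assoc]
  rw [hparts, b0, bp]
  have : ∀ y ∈ Set.uIcc 0 Real.pi, (((i + 1 : ℕ) : ℝ) * Real.cos (((i + 1 : ℕ) : ℝ) * y)
        - rr * (((i + 2 : ℕ) : ℝ) * Real.cos (((i + 2 : ℕ) : ℝ) * y)))
        * (-(1 / (2 * rr)) * (gg y)⁻¹) =
      (-(1 / (2 * rr)) * ((i + 1 : ℕ) : ℝ)) * (Real.cos (((i + 1 : ℕ) : ℝ) * y) / gg y)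
      - (-(1 / (2 * rr)) * (rr * ((i + 2 : ℕ) : ℝ)))
        * (Real.cos (((i + 2 : ℕ) : ℝ) * y) / gg y) := by
    intro y _
    ring
  rw [intervalIntegral.integral_congr this, intervalIntegral.integral_sub
    ((cc_int _).const_mul _) ((cc_int _).const_mul _),
    intervalIntegral.integral_const_mul, intervalIntegral.integral_const_mul]
  have h1 := cc_val (i + 1)
  have h2 := cc_val (i + 2)
  unfold cc at h1 h2
  rw [h1, h2]
  have hr := rr_pos.ne'
  push_cast
  field_simp
  have e : rr ^ (i + 2) = rr ^ i * (3 / 4) := by rw [pow_add, rr_sq]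
  have e1 : rr ^ (i + 1) = rr ^ i * rr := by rw [pow_succ]
  try rw [e]
  try rw [e1]
  ring_nf
  try rw [rr_sq]
  try ring

/-- Sine coefficients of sin·q_j. -/
noncomputable def VV (j m : ℕ) : ℝ :=
  (2 / Real.pi) * ∫ y in (0 : ℝ)..Real.pi, Real.sin ((m : ℝ) * y) * Real.sin y * qq j y

lemma VV_int (j m : ℕ) : IntervalIntegrable
    (fun y => Real.sin ((m : ℝ) * y) * Real.sin y * qq j y) volume 0 Real.pi := by
  apply Continuous.intervalIntegrable
  have := qq_cont j
  fun_prop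

lemma int_sin_sin (m : ℕ) : ∫ y in (0 : ℝ)..Real.pi,
    Real.sin (((m + 1 : ℕ) : ℝ) * y) * Real.sin y = if m = 0 then Real.pi / 2 else 0 := by
  have : ∀ y ∈ Set.uIcc 0 Real.pi, Real.sin (((m + 1 : ℕ) : ℝ) * y) * Real.sin y =
      1 / 2 * Real.cos ((m : ℝ) * y) - 1 / 2 * Real.cos (((m + 1 + 1 : ℕ) : ℝ) * y) := by
    intro y _
    have a1 : (m : ℝ) * y = ((m + 1 : ℕ) : ℝ) * y - y := by push_cast; ring
    have a2 : ((m + 1 + 1 : ℕ) : ℝ) * y = ((m + 1 : ℕ) : ℝ) * y + y := by push_cast; ring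
    rw [a1, a2, Real.cos_add, Real.cos_sub]; ring
  rw [intervalIntegral.integral_congr this, intervalIntegral.integral_sub
    (Continuous.intervalIntegrable (by fun_prop) _ _)
    (Continuous.intervalIntegrable (by fun_prop) _ _),
    intervalIntegral.integral_const_mul, intervalIntegral.integral_const_mul, int_cos]
  cases m with
  | zero => simp; ring
  | succ m => rw [int_cos]; simp

lemma VV_rec (j m : ℕ) : 11 / 4 * VV (j + 1) (m + 1) =
    (if m = 0 then ((j : ℝ) + 1) else 0) + VV j (m + 1)
      + rr * (VV (j + 1) (m + 2) + VV (j + 1) m) := by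
  have hI : 11 / 4 * (∫ y in (0 : ℝ)..Real.pi,
        Real.sin (((m + 1 : ℕ) : ℝ) * y) * Real.sin y * qq (j + 1) y)
      - rr * ((∫ y in (0 : ℝ)..Real.pi,
        Real.sin (((m + 2 : ℕ) : ℝ) * y) * Real.sin y * qq (j + 1) y)
        + ∫ y in (0 : ℝ)..Real.pi, Real.sin ((m : ℝ) * y) * Real.sin y * qq (j + 1) y)
      = ((j : ℝ) + 1) * (∫ y in (0 : ℝ)..Real.pi,
        Real.sin (((m + 1 : ℕ) : ℝ) * y) * Real.sin y)
        + ∫ y in (0 : ℝ)..Real.pi, Real.sin (((m + 1 : ℕ) : ℝ) * y) * Real.sin y * qq j y := by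
    rw [← intervalIntegral.integral_add (VV_int _ _) (VV_int _ _),
      ← intervalIntegral.integral_const_mul, ← intervalIntegral.integral_const_mul,
      ← intervalIntegral.integral_const_mul,
      ← intervalIntegral.integral_sub ((VV_int _ _).const_mul _)
        (((VV_int _ _).add (VV_int _ _)).const_mul _),
      ← intervalIntegral.integral_add (Continuous.intervalIntegrable (by fun_prop) _ _)
        (VV_int _ _)]
    apply intervalIntegral.integral_congr
    intro y _
    have hg : 1 + gg y ≠ 0 := by linarith [gg_pos y]
    have e1 : Real.sin (((m + 2 : ℕ) : ℝ) * y)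
        = 2 * Real.sin (((m + 1 : ℕ) : ℝ) * y) * Real.cos y - Real.sin ((m : ℝ) * y) := by
      have a1 : ((m + 2 : ℕ) : ℝ) * y = ((m + 1 : ℕ) : ℝ) * y + y := by push_cast; ring
      have a2 : (m : ℝ) * y = ((m + 1 : ℕ) : ℝ) * y - y := by push_cast; ring
      rw [a1, a2, Real.sin_add, Real.sin_sub]; ring
    have e2 : qq (j + 1) y * (1 + gg y) = (j : ℝ) + 1 + qq j y := by
      simp only [qq]; field_simp
    simp only
    rw [e1]
    unfold gg at e2
    linear_combination (Real.sin (((m + 1 : ℕ) : ℝ) * y) * Real.sin y) * e2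
  rw [int_sin_sin] at hI
  unfold VV
  have hpi := Real.pi_pos.ne'
  split_ifs at hI ⊢ with h
  · have e : (2 / Real.pi) * (((j : ℝ) + 1) * (Real.pi / 2)) = (j : ℝ) + 1 := by field_simp
    linear_combination (2 / Real.pi) * hI + e
  · linear_combination (2 / Real.pi) * hI

lemma VV_bound (j m : ℕ) : |VV j m| ≤ (j : ℝ) * (j + 1) := by
  have h := intervalIntegral.norm_integral_le_of_norm_le_const (a := 0) (b := Real.pi)
    (C := (j : ℝ) * (j + 1) / 2)
    (f := fun y => Real.sin ((m : ℝ) * y) * Real.sin y * qq j y) (by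
      intro y _
      have hq := qq_bound j y
      rw [Real.norm_eq_abs, abs_mul, abs_mul, abs_of_nonneg hq.1]
      have h1 := mul_le_one₀ (Real.abs_sin_le_one ((m : ℝ) * y)) (abs_nonneg _)
        (Real.abs_sin_le_one y)
      nlinarith [hq.1, hq.2])
  rw [sub_zero, abs_of_pos Real.pi_pos, Real.norm_eq_abs] at h
  unfold VV
  have hp := Real.pi_pos
  rw [abs_mul, abs_of_pos (by positivity : 0 < 2 / Real.pi)]
  calc _ ≤ 2 / Real.pi * ((j : ℝ) * (j + 1) / 2 * Real.pi) := by gcongr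
    _ = _ := by field_simp

/-- Rescaled coefficients. -/
noncomputable def WW (j m : ℕ) : ℝ := VV j m * rr / rr ^ m

lemma WW_final : 1 + (WW 4 7 - 3 / 4 * WW 4 8) < WW 8 3 - 3 / 4 * WW 8 4 := by
  have hr := rr_pos
  apply table_final
  · intro m; simp [WW, VV, qq]
  · intro j; simp [WW, VV]
  · intro j m
    have h := VV_rec j m
    unfold WW
    have h1 : rr / rr ^ (m + 1) = 1 / rr ^ m := by rw [pow_succ]; field_simp
    have h2 : 3 / 4 * (VV (j + 1) (m + 2) * rr / rr ^ (m + 2))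
        = rr * VV (j + 1) (m + 2) / rr ^ m := by
      rw [← rr_sq, pow_add]; field_simp
    rw [h2, mul_div_assoc, h1, mul_div_assoc (VV j (m + 1)), h1]
    split_ifs at h ⊢ with hm
    · subst hm
      simp
      linear_combination h
    · field_simp
      linear_combination 4 * h
  · intro j
    have h := VV_bound j 17
    have e : WW j 17 = VV j 17 * (4 / 3) ^ 8 := by
      unfold WW
      have : rr ^ 17 = rr * (3 / 4) ^ 8 := by
        rw [← rr_sq]; ring
      rw [this]
      field_simp
    rw [e, abs_mul, abs_of_pos (by positivity : (0 : ℝ) < (4 / 3) ^ 8)]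
    gcongr

lemma erl_lap (a : ℕ) (x : ℝ) (hx : 0 ≤ x) :
    ∫ t in Set.Ioi (0 : ℝ), erl 4 (a + 1) t * Real.exp (-(4 * t * x)) = 1 / (1 + x) ^ (a + 1) := by
  have h := Real.integral_rpow_mul_exp_neg_mul_Ioi (a := (a : ℝ) + 1) (r := 4 * (1 + x))
    (by positivity) (by positivity)
  rw [Real.Gamma_nat_eq_factorial] at h
  have hc : ∀ t : ℝ, erl 4 (a + 1) t * Real.exp (-(4 * t * x)) =
      4 ^ (a + 1) / (Nat.factorial a : ℝ) *
        (t ^ ((a : ℝ) + 1 - 1) * Real.exp (-(4 * (1 + x) * t))) := by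
    intro t
    have : -(4 * (1 + x) * t) = -(4 * t) + -(4 * t * x) := by ring
    rw [this, Real.exp_add]
    simp only [erl, Nat.add_sub_cancel, add_sub_cancel_right, Real.rpow_natCast]
    ring
  simp_rw [hc]
  rw [integral_const_mul, h]
  have : ((a : ℝ) + 1) = ((a + 1 : ℕ) : ℝ) := by push_cast; ring
  rw [this, Real.rpow_natCast]
  have hf : (Nat.factorial a : ℝ) ≠ 0 := by positivity
  have hx1 : 1 + x ≠ 0 := by positivity
  rw [one_div, inv_pow, mul_pow]
  field_simp

lemma erl_int_one (a : ℕ) : ∫ t in Set.Ioi (0 : ℝ), erl 4 (a + 1) t = 1 := by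
  have := erl_lap a 0 le_rfl
  simpa using this

lemma erl_integrable (a : ℕ) : Integrable (erl 4 (a + 1)) (volume.restrict (Set.Ioi 0)) := by
  by_contra h
  have := integral_undef h
  rw [erl_int_one] at this
  exact one_ne_zero this

lemma erl_cont (a : ℕ) : Continuous (erl 4 (a + 1)) := by
  unfold erl; fun_prop

lemma fubini_int (a b : ℕ) : Integrable (Function.uncurry (fun (y t : ℝ) =>
    erl 4 (a + 1) t * (Real.exp (-(4 * t * gg y)) / gg y ^ 2 * (aco (3 / 4) b y * Real.sin y))))
    ((volume.restrict (Set.uIoc 0 Real.pi)).prod (volume.restrict (Set.Ioi 0))) := by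
  have hinv := inv_gg_cont
  have hac := aco_cont b
  have her := erl_cont a
  have hk : Integrable (fun y => ((gg y)⁻¹) ^ 2 * (aco (3 / 4) b y * Real.sin y))
      (volume.restrict (Set.uIoc 0 Real.pi)) := by
    have : IntervalIntegrable (fun y => ((gg y)⁻¹) ^ 2 * (aco (3 / 4) b y * Real.sin y))
      volume 0 Real.pi := Continuous.intervalIntegrable (by fun_prop) _ _
    exact intervalIntegrable_iff.1 this
  have hp := hk.mul_prod (erl_integrable a)
  refine hp.mono ?_ ?_
  · apply Continuous.aestronglyMeasurable
    simp only [Function.uncurry_def, div_eq_mul_inv, ← inv_pow]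
    have h1 : Continuous (fun x : ℝ × ℝ => erl 4 (a + 1) x.2) := her.comp continuous_snd
    have h2 : Continuous (fun x : ℝ × ℝ => (gg x.1)⁻¹) := hinv.comp continuous_fst
    have h3 : Continuous (fun x : ℝ × ℝ => aco (3 / 4) b x.1) := hac.comp continuous_fst
    fun_prop
  · rw [Measure.prod_restrict]
    refine (ae_restrict_iff' (measurableSet_uIoc.prod measurableSet_Ioi)).2
      (Filter.Eventually.of_forall ?_)
    rintro ⟨y, t⟩ ⟨_, ht⟩
    simp only [Set.mem_Ioi] at ht
    have he : Real.exp (-(4 * t * gg y)) ≤ 1 := by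
      apply Real.exp_le_one_iff.2
      have := gg_pos y
      have : 0 < 4 * t * gg y := by positivity
      linarith
    have e : Function.uncurry (fun (y t : ℝ) => erl 4 (a + 1) t *
        (Real.exp (-(4 * t * gg y)) / gg y ^ 2 * (aco (3 / 4) b y * Real.sin y))) (y, t)
        = Real.exp (-(4 * t * gg y)) *
          (((gg y)⁻¹) ^ 2 * (aco (3 / 4) b y * Real.sin y) * erl 4 (a + 1) t) := by
      simp only [Function.uncurry_apply_pair]
      rw [inv_pow]
      ring
    rw [e, norm_mul, Real.norm_of_nonneg (Real.exp_pos _).le]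
    exact mul_le_of_le_one_left (norm_nonneg _) he

lemma main_integral (a b : ℕ) : ∫ t in Set.Ioi (0 : ℝ), erl 4 (a + 1) t * EL 3 4 b t =
    (2 / Real.pi) * (3 / 4 : ℝ) ^ ((1 - (b : ℝ)) / 2) *
      (∫ y in (0 : ℝ)..Real.pi, aco (3 / 4) b y * Real.sin y *
        (1 / (gg y ^ 2 * (1 + gg y) ^ (a + 1)))) + 3 := by
  have hsw := intervalIntegral_integral_swap (fubini_int a b)
  have hF := (fubini_int a b).integral_prod_right
  have hinner : ∀ y ∈ Set.uIcc 0 Real.pi, (∫ t in Set.Ioi (0 : ℝ), erl 4 (a + 1) t *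
      (Real.exp (-(4 * t * gg y)) / gg y ^ 2 * (aco (3 / 4) b y * Real.sin y))) =
      aco (3 / 4) b y * Real.sin y * (1 / (gg y ^ 2 * (1 + gg y) ^ (a + 1))) := by
    intro y _
    have hg := gg_pos y
    have : ∀ t, erl 4 (a + 1) t *
      (Real.exp (-(4 * t * gg y)) / gg y ^ 2 * (aco (3 / 4) b y * Real.sin y)) =
      (aco (3 / 4) b y * Real.sin y / gg y ^ 2) *
        (erl 4 (a + 1) t * Real.exp (-(4 * t * gg y))) := by
      intro t; ring
    simp_rw [this]
    rw [integral_const_mul, erl_lap a _ hg.le]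
    have : 1 + gg y ≠ 0 := by positivity
    field_simp
  rw [intervalIntegral.integral_congr hinner] at hsw
  rw [hsw]
  have hEL : ∀ t, erl 4 (a + 1) t * EL 3 4 b t =
      (2 / Real.pi) * (3 / 4 : ℝ) ^ ((1 - (b : ℝ)) / 2) *
      (∫ y in (0 : ℝ)..Real.pi, erl 4 (a + 1) t *
        (Real.exp (-(4 * t * gg y)) / gg y ^ 2 * (aco (3 / 4) b y * Real.sin y)))
      + 3 * erl 4 (a + 1) t := by
    intro t
    rw [intervalIntegral.integral_const_mul]
    unfold EL
    simp_rw [gam_eq]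
    ring
  simp_rw [hEL]
  rw [integral_add, integral_const_mul, integral_const_mul, erl_int_one, mul_one]
  · refine Integrable.const_mul ?_ _
    simp_rw [intervalIntegral.integral_of_le Real.pi_pos.le]
    rw [Set.uIoc_of_le Real.pi_pos.le] at hF
    exact hF
  · exact (erl_integrable a).const_mul _

lemma split_integral (n i : ℕ) :
    (2 / Real.pi) * (∫ y in (0 : ℝ)..Real.pi, aco (3 / 4) (i + 1) y * Real.sin y *
        (1 / (gg y ^ 2 * (1 + gg y) ^ n)))
    = rr ^ i * ((i : ℝ) - 2 - n / 4) + (VV n (i + 1) - rr * VV n (i + 2)) := by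
  have hinv := inv_gg_cont
  have hac := aco_cont (i + 1)
  have hq := qq_cont n
  have i2 : IntervalIntegrable (fun y => aco (3 / 4) (i + 1) y * Real.sin y * (1 / gg y ^ 2))
      volume 0 Real.pi := by
    apply Continuous.intervalIntegrable
    simp only [one_div, ← inv_pow]
    fun_prop
  have i1 : IntervalIntegrable (fun y => aco (3 / 4) (i + 1) y * Real.sin y * (1 / gg y))
      volume 0 Real.pi := by
    apply Continuous.intervalIntegrable
    simp only [one_div]
    fun_prop
  have hc : ∀ y ∈ Set.uIcc 0 Real.pi, aco (3 / 4) (i + 1) y * Real.sin y *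
        (1 / (gg y ^ 2 * (1 + gg y) ^ n)) =
      (aco (3 / 4) (i + 1) y * Real.sin y * (1 / gg y ^ 2)
        - n * (aco (3 / 4) (i + 1) y * Real.sin y * (1 / gg y)))
      + (Real.sin (((i + 1 : ℕ) : ℝ) * y) * Real.sin y * qq n y
        - rr * (Real.sin (((i + 2 : ℕ) : ℝ) * y) * Real.sin y * qq n y)) := by
    intro y _
    rw [partial_fraction]
    have : (((i + 2 : ℕ) : ℝ) * y) = (((i + 1 : ℕ) : ℝ) + 1) * y := by push_cast; ring
    rw [this]
    have : aco (3 / 4) (i + 1) y = Real.sin (((i + 1 : ℕ) : ℝ) * y)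
      - rr * Real.sin ((((i + 1 : ℕ) : ℝ) + 1) * y) := rfl
    rw [this]
    ring
  rw [intervalIntegral.integral_congr hc, intervalIntegral.integral_add
    (i2.sub (i1.const_mul _)) ((VV_int _ _).sub ((VV_int _ _).const_mul _)),
    intervalIntegral.integral_sub i2 (i1.const_mul _),
    intervalIntegral.integral_sub (VV_int _ _) ((VV_int _ _).const_mul _),
    intervalIntegral.integral_const_mul, intervalIntegral.integral_const_mul, int_one, int_two]
  unfold VV
  have hpi := Real.pi_pos.ne'
  have e : (2 / Real.pi) * Real.pi = 2 := by field_simp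
  linear_combination (rr ^ i * ((i : ℝ) - 2) / 2 - n * rr ^ i / 8) * e

/-- For λ = 3, μ = 4: joining the shorter queue (3) first beats joining the longer (7) first. -/
theorem ETT_shorter_first_3_7 : ETT 3 4 3 7 < ETT 3 4 7 3 := by
  have h1 := split_integral 4 6
  have h2 := split_integral 8 2
  have hw := WW_final
  have p1 : (3 / 4 : ℝ) ^ ((1 - ((7 : ℕ) : ℝ)) / 2) = 64 / 27 := by
    have : ((1 - ((7 : ℕ) : ℝ)) / 2) = -((3 : ℕ) : ℝ) := by norm_num
    rw [this, Real.rpow_neg (by norm_num), Real.rpow_natCast]; norm_num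
  have p2 : (3 / 4 : ℝ) ^ ((1 - ((3 : ℕ) : ℝ)) / 2) = 4 / 3 := by
    have : ((1 - ((3 : ℕ) : ℝ)) / 2) = -((1 : ℕ) : ℝ) := by norm_num
    rw [this, Real.rpow_neg (by norm_num), Real.rpow_natCast]; norm_num
  have hr := rr_pos.ne'
  have q2 := rr_sq
  have q3 : rr ^ 3 = 3 / 4 * rr := by rw [← rr_sq]; ring
  have q4 : rr ^ 4 = 9 / 16 := by
    have : rr ^ 4 = (rr ^ 2) ^ 2 := by ring
    rw [this, rr_sq]; norm_num
  have q6 : rr ^ 6 = 27 / 64 := by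
    have : rr ^ 6 = (rr ^ 2) ^ 3 := by ring
    rw [this, rr_sq]; norm_num
  have q7 : rr ^ 7 = 27 / 64 * rr := by rw [← q6]; ring
  have q8 : rr ^ 8 = 81 / 256 := by
    have : rr ^ 8 = (rr ^ 2) ^ 4 := by ring
    rw [this, rr_sq]; norm_num
  have w1 : WW 4 7 = 64 / 27 * VV 4 7 := by
    unfold WW; rw [q7]; field_simp
  have w2 : WW 4 8 = 256 / 81 * (rr * VV 4 8) := by
    unfold WW; rw [q8]; ring
  have w3 : WW 8 3 = 4 / 3 * VV 8 3 := by
    unfold WW; rw [q3]; field_simp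
  have w4 : WW 8 4 = 16 / 9 * (rr * VV 8 4) := by
    unfold WW; rw [q4]; ring
  rw [w1, w2, w3, w4] at hw
  unfold ETT
  rw [main_integral, main_integral, p1, p2]
  rw [q6] at h1
  rw [q2] at h2
  norm_num at h1 h2 hw ⊢
  linarith
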